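/- arXiv:dg-ga/9702001 — 5 statements merged into one kernel-verified Lean document; each statement's English description precedes it below -/
import Mathlib

section
/- Let n ≥ 1, let L > 0, and let γ : ℝ → ℝⁿ be a 1-Lipschitz map with γ(s + L) = γ(s) for all s ∈ ℝ. Then there exists s ∈ ℝ such that ‖γ(s) − γ(s + L/2)‖ ≤ L/π. -/
open InnerProductGeometry in
/-- Two vectors of norm at least `r` that subtend an angle `θ` are at distance at least
`2 * r * sin (θ / 2)`. -/
theorem two_mul_mul_sin_half_angle_le_norm_sub {V : Type*} [NormedAddCommGroup V]
    [InnerProductSpace ℝ V] {x y : V} {r : ℝ} (hr : 0 ≤ r) (hx : r ≤ ‖x‖) (hy : r ≤ ‖y‖) :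
    2 * r * Real.sin (angle x y / 2) ≤ ‖x - y‖ := by
  have hlaw := norm_sub_sq_eq_norm_sq_add_norm_sq_sub_two_mul_norm_mul_norm_mul_cos_angle x y
  have hcos : Real.cos (angle x y) = 1 - 2 * Real.sin (angle x y / 2) ^ 2 := by
    have h := Real.cos_two_mul (angle x y / 2)
    rw [mul_div_cancel₀ _ two_ne_zero] at h
    linarith [Real.sin_sq_add_cos_sq (angle x y / 2)]
  rw [hcos] at hlaw
  have hprod : r * r ≤ ‖x‖ * ‖y‖ := by gcongr
  refine abs_le_of_sq_le_sq' ?_ (norm_nonneg _) |>.2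
  nlinarith [sq_nonneg (‖x‖ - ‖y‖),
    mul_le_mul_of_nonneg_right hprod (sq_nonneg (Real.sin (angle x y / 2)))]

open InnerProductGeometry in
/-- The angle between the endpoints of a chain of nonzero vectors is at most the sum of the
angles of its steps. -/
theorem angle_chain_le {V : Type*} [NormedAddCommGroup V] [InnerProductSpace ℝ V]
    {u : ℕ → V} {c : ℝ} (h0 : u 0 ≠ 0) (hc : ∀ k, angle (u k) (u (k + 1)) ≤ c) (k : ℕ) :
    angle (u 0) (u k) ≤ k * c := by
  induction k with
  | zero => simp [angle_self h0]
  | succ k ih =>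
    push_cast
    linarith [angle_le_angle_add_angle (u 0) (u k) (u (k + 1)), hc k]

open InnerProductGeometry Filter Topology in
/-- A Lipschitz curve joining `x ≠ 0` to `-x` outside the ball of radius `r` covers
a length of at least `π * r`. -/
theorem pi_mul_le_of_antipodal {V : Type*} [NormedAddCommGroup V] [InnerProductSpace ℝ V]
    {f : ℝ → V} {K : NNReal} (hf : LipschitzWith K f) {T r : ℝ} (hT : 0 ≤ T)
    (hr : 0 < r) (hfr : ∀ s, r ≤ ‖f s‖) (hanti : f T = -f 0) :
    Real.pi * r ≤ K * T := by
  have h0 : f 0 ≠ 0 := norm_pos_iff.mp (hr.trans_le (hfr 0))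
  have hsin : ∀ m : ℕ, 0 < m → Real.sin (Real.pi / (2 * m)) ≤ K * (T / m) / (2 * r) := by
    intro m hm
    have hm' : (1 : ℝ) ≤ m := by exact_mod_cast hm
    have hstep : ∀ k : ℕ, angle (f (k * (T / m))) (f ((k + 1 : ℕ) * (T / m))) ≤
        2 * Real.arcsin (K * (T / m) / (2 * r)) := by
      intro k
      set θ := angle (f (k * (T / m))) (f ((k + 1 : ℕ) * (T / m)))
      have hθ : 0 ≤ θ := angle_nonneg _ _
      have hθπ : θ ≤ Real.pi := angle_le_pi _ _
      have hchord : 2 * r * Real.sin (θ / 2) ≤ _ :=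
        two_mul_mul_sin_half_angle_le_norm_sub hr.le (hfr _) (hfr _)
      have hlip := hf.norm_sub_le (k * (T / m)) ((k + 1 : ℕ) * (T / m))
      have hdist : ‖k * (T / m) - (k + 1 : ℕ) * (T / m)‖ = T / m := by
        rw [show k * (T / m) - (k + 1 : ℕ) * (T / m) = -(T / m) by push_cast; ring, norm_neg,
          Real.norm_of_nonneg (by positivity)]
      rw [hdist] at hlip
      have : θ / 2 ≤ Real.arcsin (K * (T / m) / (2 * r)) := by
        rw [Real.le_arcsin_iff_sin_le' ⟨by linarith [Real.pi_pos], by linarith⟩,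
          le_div_iff₀ (by positivity)]
        linarith
      linarith
    have hchain := angle_chain_le (u := fun k : ℕ => f (k * (T / m))) (by simpa using h0) hstep m
    have hend : (m : ℝ) * (T / m) = T := by field_simp
    simp only [Nat.cast_zero, zero_mul, hend, hanti, angle_self_neg_of_nonzero h0] at hchain
    have hπm : Real.pi / (2 * m) ≤ Real.pi / 2 := by gcongr; linarith
    rw [← Real.le_arcsin_iff_sin_le' ⟨?_, hπm⟩]
    · rw [div_le_iff₀ (by positivity)]
      linarith
    · have : 0 < Real.pi / (2 * m) := by positivity
      linarith [Real.pi_pos]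
  have hlim : Tendsto (fun m : ℕ => Real.pi * r * Real.sinc (Real.pi / 2 / m)) atTop
      (𝓝 (Real.pi * r)) := by
    simpa using ((Real.continuous_sinc.tendsto 0).comp
      (tendsto_const_div_atTop_nhds_zero_nat (Real.pi / 2))).const_mul (Real.pi * r)
  refine le_of_tendsto hlim ?_
  filter_upwards [eventually_gt_atTop 0] with m hm
  have hm' : (0 : ℝ) < m := by exact_mod_cast hm
  have h := hsin m hm
  rw [le_div_iff₀ (by positivity)] at h
  rw [Real.sinc_of_ne_zero (by positivity), div_div]
  calc Real.pi * r * (Real.sin (Real.pi / (2 * m)) / (Real.pi / (2 * m)))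
      = Real.sin (Real.pi / (2 * m)) * (2 * r) * m := by field_simp
    _ ≤ K * (T / m) * m := by gcongr
    _ = K * T := by field_simp


/-- For a 1-Lipschitz `L`-periodic curve `γ : ℝ → ℝⁿ` (`L > 0`), some
pair of opposite points `γ s`, `γ (s + L/2)` is at distance at most `L/π`. -/
theorem exists_opposite_points_close (n : ℕ) (hn : 1 ≤ n) (L : ℝ) (hL : 0 < L)
    (γ : ℝ → EuclideanSpace ℝ (Fin n))
    (hlip : LipschitzWith 1 γ) (hper : ∀ s : ℝ, γ (s + L) = γ s) :
    ∃ s : ℝ, ‖γ s - γ (s + L / 2)‖ ≤ L / Real.pi := by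
  set f : ℝ → EuclideanSpace ℝ (Fin n) := fun s => γ s - γ (s + L / 2) with hf
  have hanti : ∀ s, f (s + L / 2) = -f s := by
    intro s
    simp only [hf, add_assoc, add_halves, hper, neg_sub]
  have hshift : LipschitzWith 1 (fun s : ℝ => s + L / 2) :=
    LipschitzWith.of_dist_le_mul fun x y => by simp
  have hflip : LipschitzWith (1 + 1 * 1) f := hlip.sub (hlip.comp hshift)
  have hnper : Function.Periodic (fun s => ‖f s‖) (L / 2) := fun s => by
    simp only [hanti, norm_neg]
  obtain ⟨s₀, -, hs₀⟩ := isCompact_Icc.exists_isMinOn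
    (Set.nonempty_Icc.mpr (half_pos hL).le) hflip.continuous.norm.continuousOn
  refine ⟨s₀, ?_⟩
  have hmin : ∀ s, ‖f s₀‖ ≤ ‖f s‖ := by
    intro s
    obtain ⟨t, ht, hst⟩ := hnper.exists_mem_Ico₀ (half_pos hL) s
    exact (hs₀ (Set.Ico_subset_Icc_self ht)).trans_eq hst.symm
  change ‖f s₀‖ ≤ L / Real.pi
  rcases (norm_nonneg (f s₀)).eq_or_lt with h | h
  · rw [← h]
    positivity
  · have hlen := pi_mul_le_of_antipodal hflip (half_pos hL).le h hmin (by simpa using hanti 0)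
    rw [le_div_iff₀ Real.pi_pos]
    push_cast at hlen
    linarith
end

section
/- Let γ_k (k = 1, 2, …) and γ be closed rectifiable curves in ℝⁿ (continuous 1-periodic maps ℝ → ℝⁿ, injective on [0,1), of finite length), and suppose γ_k → γ uniformly. Then δ(γ) ≤ liminf_{k→∞} δ(γ_k) (as elements of [1, ∞]). That is, the distortion is lower semicontinuous in the C⁰ topology on closed curves. -/
open scoped ENNReal

/-- A closed rectifiable curve with period 1: continuous, 1-periodic, injective on
`[0,1)`, of finite length (total variation on `[0,1]`). -/
def IsClosedRectifiableCurve {E : Type*} [NormedAddCommGroup E] (γ : ℝ → E) : Prop :=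
  Continuous γ ∧ (∀ s : ℝ, γ (s + 1) = γ s) ∧ Set.InjOn γ (Set.Ico 0 1) ∧
    eVariationOn γ (Set.Icc 0 1) < ⊤

/-- The length of a period-1 curve: total variation on `[0,1]`. -/
noncomputable def curveLength {E : Type*} [NormedAddCommGroup E] (γ : ℝ → E) : ℝ≥0∞ :=
  eVariationOn γ (Set.Icc 0 1)

/-- The arclength distance between parameters `s` and `t` with `s - t ∉ ℤ` along a
period-1 curve: taking the representative `t' = s + Int.fract (t - s) ∈ [s, s+1)` of `t`,
it is the smaller of the variations of `γ` on `[s, t']` and on `[t', s+1]`. -/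
noncomputable def arcDistC0 {E : Type*} [NormedAddCommGroup E] (γ : ℝ → E) (s t : ℝ) : ℝ≥0∞ :=
  min (eVariationOn γ (Set.Icc s (s + Int.fract (t - s))))
      (eVariationOn γ (Set.Icc (s + Int.fract (t - s)) (s + 1)))

/-- The distortion of a pair of parameters: `d_γ(s,t)/‖γ s - γ t‖ ∈ (0,∞]`
(with value `∞` when `γ s = γ t`). -/
noncomputable def pairDistortionC0 {E : Type*} [NormedAddCommGroup E]
    (γ : ℝ → E) (s t : ℝ) : ℝ≥0∞ :=
  arcDistC0 γ s t / ENNReal.ofReal ‖γ s - γ t‖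

/-- The distortion `δ(γ)`: supremum of pair distortions over pairs with `s - t ∉ ℤ`. -/
noncomputable def distortionC0 {E : Type*} [NormedAddCommGroup E] (γ : ℝ → E) : ℝ≥0∞ :=
  ⨆ (s : ℝ) (t : ℝ) (_ : ¬ ∃ m : ℤ, s - t = (m : ℝ)), pairDistortionC0 γ s t

/-- The distortion thickness `τ_b(γ)`: infimum of chord lengths `‖γ s - γ t‖` over
pairs with `s - t ∉ ℤ` whose distortion exceeds `b` (`∞` if there are none). -/
noncomputable def distortionThicknessC0 {E : Type*} [NormedAddCommGroup E]
    (γ : ℝ → E) (b : ℝ) : ℝ≥0∞ :=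
  ⨅ (s : ℝ) (t : ℝ) (_ : ¬ ∃ m : ℤ, s - t = (m : ℝ))
    (_ : ENNReal.ofReal b < pairDistortionC0 γ s t), ENNReal.ofReal ‖γ s - γ t‖

open Filter Topology in
/-- Pair distortion is lower semicontinuous under pointwise convergence. -/
theorem eventually_lt_pairDistortionC0 {ι E : Type*} [NormedAddCommGroup E] {l : Filter ι}
    {F : ι → ℝ → E} {f : ℝ → E} (hF : ∀ x, Tendsto (fun k => F k x) l (𝓝 (f x)))
    (s t : ℝ) {c : ℝ≥0∞} (hc : c < pairDistortionC0 f s t) :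
    ∀ᶠ k in l, c < pairDistortionC0 (F k) s t := by
  have hc_top : c ≠ ⊤ := hc.ne_top
  have hc_mul : c * ENNReal.ofReal ‖f s - f t‖ < arcDistC0 f s t :=
    (ENNReal.lt_div_iff_mul_lt (Or.inr hc_top) (Or.inl ENNReal.ofReal_ne_top)).1 hc
  obtain ⟨m, hm, hm_arc⟩ := exists_between hc_mul
  have hchord : Tendsto (fun k => c * ENNReal.ofReal ‖F k s - F k t‖) l
      (𝓝 (c * ENNReal.ofReal ‖f s - f t‖)) :=
    ENNReal.Tendsto.const_mul (ENNReal.tendsto_ofReal ((hF s).sub (hF t)).norm)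
      (Or.inr hc_top)
  obtain ⟨hm_left, hm_right⟩ := lt_min_iff.1 hm_arc
  filter_upwards [hchord.eventually_lt_const hm,
    eVariationOn.lowerSemicontinuous_aux (fun x _ => hF x) hm_left,
    eVariationOn.lowerSemicontinuous_aux (fun x _ => hF x) hm_right] with k hk hk_left hk_right
  exact (ENNReal.lt_div_iff_mul_lt (Or.inr hc_top) (Or.inl ENNReal.ofReal_ne_top)).2
    (hk.trans (lt_min hk_left hk_right))

/-- Distortion is lower semicontinuous in the `C⁰` topology: if closed
rectifiable curves `γₖ` converge uniformly to `γ`, then `δ(γ) ≤ liminf δ(γₖ)`. -/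
theorem distortion_lowerSemicontinuous (n : ℕ) (hn : 1 ≤ n)
    (γk : ℕ → ℝ → EuclideanSpace ℝ (Fin n)) (γ : ℝ → EuclideanSpace ℝ (Fin n))
    (hk : ∀ k : ℕ, IsClosedRectifiableCurve (γk k))
    (hγ : IsClosedRectifiableCurve γ)
    (hconv : TendstoUniformly γk γ Filter.atTop) :
    distortionC0 γ ≤ Filter.atTop.liminf (fun k => distortionC0 (γk k)) := by
  refine iSup_le fun s => iSup_le fun t => iSup_le fun hst => le_of_forall_lt fun c hc => ?_
  obtain ⟨d, hcd, hd⟩ := exists_between hc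
  refine hcd.trans_le (Filter.le_liminf_of_le (by isBoundedDefault) ?_)
  filter_upwards [eventually_lt_pairDistortionC0 hconv.tendsto_at s t hd] with k hlt
  exact hlt.le.trans (le_iSup_of_le s (le_iSup_of_le t (le_iSup_of_le hst le_rfl)))
end

section
/- Fix b ≥ 1. Let γ_k (k = 1, 2, …) and γ be closed rectifiable curves in ℝⁿ (continuous 1-periodic maps ℝ → ℝⁿ, injective on [0,1), of finite length), and suppose γ_k → γ uniformly. Then limsup_{k→∞} τ_b(γ_k) ≤ τ_b(γ) (as elements of [0, ∞]). That is, for each fixed b the distortion thickness τ_b is upper semicontinuous in the C⁰ topology on closed curves. -/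
open scoped ENNReal

/-- If the variation of the limit on `S` exceeds `b` times its chord, then the same holds
eventually along a pointwise convergent sequence. -/
theorem eventually_mul_chord_lt_eVariationOn {E : Type*} [NormedAddCommGroup E]
    {γk : ℕ → ℝ → E} {γ : ℝ → E}
    (h : ∀ x, Filter.Tendsto (fun k => γk k x) Filter.atTop (nhds (γ x)))
    {b : ℝ} {s t : ℝ} {S : Set ℝ}
    (hlt : ENNReal.ofReal b * ENNReal.ofReal ‖γ s - γ t‖ < eVariationOn γ S) :
    ∀ᶠ k in Filter.atTop,
      ENNReal.ofReal b * ENNReal.ofReal ‖γk k s - γk k t‖ < eVariationOn (γk k) S := by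
  obtain ⟨q, hq, hqV⟩ := exists_between hlt
  have hchord : Filter.Tendsto
      (fun k => ENNReal.ofReal b * ENNReal.ofReal ‖γk k s - γk k t‖) Filter.atTop
      (nhds (ENNReal.ofReal b * ENNReal.ofReal ‖γ s - γ t‖)) :=
    ENNReal.Tendsto.const_mul (ENNReal.tendsto_ofReal ((h s).sub (h t)).norm)
      (Or.inr ENNReal.ofReal_ne_top)
  filter_upwards [hchord.eventually_lt_const hq,
    eVariationOn.lowerSemicontinuous_aux (fun x _ => h x) hqV] with k h₁ h₂
  exact h₁.trans h₂

/-- A pair has distortion greater than `b` iff both arcs are longer than `b` times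
the chord. -/
theorem lt_pairDistortionC0_iff {E : Type*} [NormedAddCommGroup E] {γ : ℝ → E}
    {b s t : ℝ} :
    ENNReal.ofReal b < pairDistortionC0 γ s t ↔
      ENNReal.ofReal b * ENNReal.ofReal ‖γ s - γ t‖ <
          eVariationOn γ (Set.Icc s (s + Int.fract (t - s))) ∧
        ENNReal.ofReal b * ENNReal.ofReal ‖γ s - γ t‖ <
          eVariationOn γ (Set.Icc (s + Int.fract (t - s)) (s + 1)) := by
  rw [pairDistortionC0, arcDistC0,
    ENNReal.lt_div_iff_mul_lt (Or.inr ENNReal.ofReal_ne_top)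
      (Or.inl ENNReal.ofReal_ne_top), lt_min_iff]

/-- For fixed `b ≥ 1`, the distortion thickness `τ_b` is upper
semicontinuous in the `C⁰` topology: if closed rectifiable curves `γₖ` converge
uniformly to `γ`, then `limsup τ_b(γₖ) ≤ τ_b(γ)`. -/
theorem distortionThickness_upperSemicontinuous (n : ℕ) (hn : 1 ≤ n) (b : ℝ) (hb : 1 ≤ b)
    (γk : ℕ → ℝ → EuclideanSpace ℝ (Fin n)) (γ : ℝ → EuclideanSpace ℝ (Fin n))
    (hk : ∀ k : ℕ, IsClosedRectifiableCurve (γk k))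
    (hγ : IsClosedRectifiableCurve γ)
    (hconv : TendstoUniformly γk γ Filter.atTop) :
    Filter.atTop.limsup (fun k => distortionThicknessC0 (γk k) b) ≤
      distortionThicknessC0 γ b := by
  have hpt (x : ℝ) : Filter.Tendsto (fun k => γk k x) Filter.atTop (nhds (γ x)) :=
    hconv.tendsto_at x
  refine le_iInf fun s => le_iInf fun t => le_iInf fun hst => le_iInf fun hδ => ?_
  obtain ⟨h₁, h₂⟩ := lt_pairDistortionC0_iff.1 hδ
  have hlim : Filter.Tendsto (fun k => ENNReal.ofReal ‖γk k s - γk k t‖) Filter.atTop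
      (nhds (ENNReal.ofReal ‖γ s - γ t‖)) :=
    ENNReal.tendsto_ofReal ((hpt s).sub (hpt t)).norm
  rw [← hlim.limsup_eq]
  refine Filter.limsup_le_limsup ?_
  filter_upwards [eventually_mul_chord_lt_eVariationOn hpt h₁,
    eventually_mul_chord_lt_eVariationOn hpt h₂] with k hk₁ hk₂
  exact iInf_le_of_le s (iInf_le_of_le t (iInf_le_of_le hst
    (iInf_le_of_le (lt_pairDistortionC0_iff.2 ⟨hk₁, hk₂⟩) le_rfl)))
end

section
/- Fix b ≥ 1. Let γ_k (k = 1, 2, …) and γ be closed rectifiable curves in ℝⁿ (continuous 1-periodic maps ℝ → ℝⁿ, injective on [0,1), of finite length), and suppose γ_k → γ uniformly. Then L(γ)/τ_b(γ) ≤ liminf_{k→∞} L(γ_k)/τ_b(γ_k), where the quotients are taken in [0, ∞] with the conventions x/∞ = 0 and x/0 = ∞ for x > 0. That is, the distortion ropelength L/τ_b is lower semicontinuous in the C⁰ topology on closed curves. -/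
open scoped ENNReal

open Filter Topology

/-- The arclength distance of a fixed pair of parameters is lower semicontinuous under
pointwise convergence. -/
theorem eventually_lt_arcDistC0 {E : Type*} [NormedAddCommGroup E] {γk : ℕ → ℝ → E} {γ : ℝ → E}
    (h : ∀ x, Tendsto (fun k => γk k x) atTop (𝓝 (γ x))) {s t : ℝ} {c : ℝ≥0∞}
    (hc : c < arcDistC0 γ s t) : ∀ᶠ k in atTop, c < arcDistC0 (γk k) s t := by
  obtain ⟨h₁, h₂⟩ := lt_min_iff.1 hc
  filter_upwards [eVariationOn.lowerSemicontinuous_aux (fun x _ => h x) h₁,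
    eVariationOn.lowerSemicontinuous_aux (fun x _ => h x) h₂] with k hk₁ hk₂
  exact lt_min hk₁ hk₂

theorem tendsto_ofReal_norm_sub {E : Type*} [NormedAddCommGroup E] {γk : ℕ → ℝ → E} {γ : ℝ → E}
    (h : ∀ x, Tendsto (fun k => γk k x) atTop (𝓝 (γ x))) (s t : ℝ) :
    Tendsto (fun k => ENNReal.ofReal ‖γk k s - γk k t‖) atTop
      (𝓝 (ENNReal.ofReal ‖γ s - γ t‖)) :=
  ENNReal.tendsto_ofReal ((h s).sub (h t)).norm

/-- The distortion of a fixed pair of parameters is lower semicontinuous under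
pointwise convergence. -/
theorem eventually_lt_pairDistortionC0_s6 {E : Type*} [NormedAddCommGroup E] {γk : ℕ → ℝ → E}
    {γ : ℝ → E} (h : ∀ x, Tendsto (fun k => γk k x) atTop (𝓝 (γ x))) {s t : ℝ} {b : ℝ≥0∞}
    (hb : b < pairDistortionC0 γ s t) : ∀ᶠ k in atTop, b < pairDistortionC0 (γk k) s t := by
  have hbtop : b ≠ ⊤ := hb.ne_top
  obtain ⟨c, hc₁, hc₂⟩ := exists_between (ENNReal.mul_lt_of_lt_div hb)
  filter_upwards [eventually_lt_arcDistC0 h hc₂,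
    (ENNReal.Tendsto.const_mul (tendsto_ofReal_norm_sub h s t)
      (Or.inr hbtop)).eventually_lt_const hc₁] with k hk₁ hk₂
  rw [pairDistortionC0, ENNReal.lt_div_iff_mul_lt (Or.inr hbtop) (Or.inl ENNReal.ofReal_ne_top)]
  exact hk₂.trans hk₁

/-- For fixed `b ≥ 1`, the distortion ropelength `L/τ_b` is lower
semicontinuous in the `C⁰` topology: if closed rectifiable curves `γₖ` converge
uniformly to `γ`, then `L(γ)/τ_b(γ) ≤ liminf L(γₖ)/τ_b(γₖ)`, the quotients being
taken in `[0,∞]` (so `x/∞ = 0` and `x/0 = ∞` for `x > 0`). -/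
theorem ropelength_lowerSemicontinuous (n : ℕ) (hn : 1 ≤ n) (b : ℝ) (hb : 1 ≤ b)
    (γk : ℕ → ℝ → EuclideanSpace ℝ (Fin n)) (γ : ℝ → EuclideanSpace ℝ (Fin n))
    (hk : ∀ k : ℕ, IsClosedRectifiableCurve (γk k))
    (hγ : IsClosedRectifiableCurve γ)
    (hconv : TendstoUniformly γk γ Filter.atTop) :
    curveLength γ / distortionThicknessC0 γ b ≤
      Filter.atTop.liminf (fun k => curveLength (γk k) / distortionThicknessC0 (γk k) b) := by
  have h : ∀ x, Tendsto (fun k => γk k x) atTop (𝓝 (γ x)) := fun x => hconv.tendsto_at x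
  refine le_of_forall_lt fun a ha => ?_
  obtain ⟨a', haa', ha'⟩ := exists_between ha
  refine haa'.trans_le (le_liminf_of_le (by isBoundedDefault) ?_)
  have ha'0 : a' ≠ 0 := haa'.ne_bot
  have ha'top : a' ≠ ⊤ := ha'.ne_top
  have hlt : distortionThicknessC0 γ b < curveLength γ / a' := by
    rw [ENNReal.lt_div_iff_mul_lt (Or.inl ha'0) (Or.inl ha'top), mul_comm]
    exact ENNReal.mul_lt_of_lt_div ha'
  simp only [distortionThicknessC0, iInf_lt_iff] at hlt
  obtain ⟨s, t, hst, hbst, hlt⟩ := hlt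
  have hlt := ENNReal.mul_lt_of_lt_div hlt
  rw [mul_comm] at hlt
  obtain ⟨c, hc₁, hc₂⟩ := exists_between hlt
  filter_upwards [eventually_lt_pairDistortionC0_s6 h hbst,
    (ENNReal.Tendsto.const_mul (tendsto_ofReal_norm_sub h s t)
      (Or.inr ha'top)).eventually_lt_const hc₁,
    eVariationOn.lowerSemicontinuous_aux (fun x _ => h x) hc₂] with k hk₁ hk₂ hk₃
  have hτ : distortionThicknessC0 (γk k) b ≤ ENNReal.ofReal ‖γk k s - γk k t‖ :=
    iInf₂_le_of_le s t (iInf₂_le hst hk₁)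
  refine (ENNReal.le_div_iff_mul_le (Or.inr hk₃.ne_bot) (Or.inr (hk k).2.2.2.ne)).2 ?_
  exact (mul_le_mul_right hτ a').trans (hk₂.trans hk₃).le
end

section
/- Let γ : ℝ → ℝⁿ be differentiable with ‖γ'(s)‖ = 1 for all s and with γ' Lipschitz with constant 1 (curvature at most 1 almost everywhere). Then for all parameters s, t with |s − t| ≤ 2π, ‖γ(s) − γ(t)‖ ≥ 2·sin(|s − t|/2). Equivalently, for 0 < |s − t| ≤ 2π the chord-to-arc ratio satisfies |s − t|/‖γ(s) − γ(t)‖ ≤ (|s−t|/2)/sin(|s−t|/2). -/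
open InnerProductGeometry in
/-- The angle between two unit vectors at distance at most `δ` is at most `2 * arcsin (δ / 2)`. -/
theorem angle_le_two_mul_arcsin {E : Type*} [NormedAddCommGroup E] [InnerProductSpace ℝ E]
    {x y : E} (hx : ‖x‖ = 1) (hy : ‖y‖ = 1) {δ : ℝ} (hδ : ‖x - y‖ ≤ δ) (hδ2 : δ ≤ 2) :
    angle x y ≤ 2 * Real.arcsin (δ / 2) := by
  have h0 : 0 ≤ δ := (norm_nonneg _).trans hδ
  have ha0 := angle_nonneg x y
  have haπ := angle_le_pi x y
  have hπ := Real.pi_pos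
  have hcos : ‖x - y‖ ^ 2 = 2 - 2 * Real.cos (angle x y) := by
    rw [norm_sub_sq_real, hx, hy, cos_angle, hx, hy]
    ring
  have hhalf : Real.cos (angle x y) = 1 - 2 * Real.sin (angle x y / 2) ^ 2 := by
    have h := Real.cos_two_mul' (angle x y / 2)
    rw [mul_div_cancel₀ _ two_ne_zero, Real.cos_sq'] at h
    linarith
  have hsq : ‖x - y‖ ^ 2 ≤ δ ^ 2 := pow_le_pow_left₀ (norm_nonneg _) hδ 2
  have hsin : Real.sin (angle x y / 2) ≤ δ / 2 :=
    (abs_le_of_sq_le_sq' (by nlinarith) (by linarith)).2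
  have := (Real.le_arcsin_iff_sin_le (x := angle x y / 2) (y := δ / 2)
    ⟨by linarith, by linarith⟩ ⟨by linarith, by linarith⟩).2 hsin
  linarith

open Filter Topology in
theorem tendsto_nat_mul_two_mul_arcsin (h : ℝ) :
    Tendsto (fun N : ℕ => (N : ℝ) * (2 * Real.arcsin (h / N / 2))) atTop (𝓝 h) := by
  rcases eq_or_ne h 0 with rfl | hh
  · simp
  have hd : HasDerivAt Real.arcsin 1 0 := by
    simpa using Real.hasDerivAt_arcsin (x := 0) (by norm_num) (by norm_num)
  have hlim : Tendsto (fun N : ℕ => h / N / 2) atTop (𝓝[≠] 0) := by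
    refine tendsto_nhdsWithin_iff.2 ⟨?_, ?_⟩
    · simpa using (tendsto_const_div_atTop_nhds_zero_nat h).div_const 2
    · filter_upwards [eventually_gt_atTop 0] with N hN
      have : (N : ℝ) ≠ 0 := by positivity
      simp [hh, this]
  have := (hd.tendsto_slope_zero.comp hlim).const_mul h
  rw [mul_one] at this
  refine this.congr' ?_
  filter_upwards [eventually_gt_atTop 0] with N hN
  have : (N : ℝ) ≠ 0 := by positivity
  simp only [Function.comp_apply, zero_add, Real.arcsin_zero, sub_zero, smul_eq_mul]
  field_simp

open InnerProductGeometry Filter in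
/-- Along a `1`-Lipschitz curve in the unit sphere, angles grow at most at unit rate. -/
theorem LipschitzWith.angle_le_dist {E : Type*} [NormedAddCommGroup E] [InnerProductSpace ℝ E]
    {T : ℝ → E} (hT : LipschitzWith 1 T) (hunit : ∀ s, ‖T s‖ = 1) (a b : ℝ) :
    angle (T a) (T b) ≤ |a - b| := by
  refine ge_of_tendsto (tendsto_nat_mul_two_mul_arcsin |a - b|) ?_
  have hsmall : ∀ᶠ N : ℕ in atTop, |a - b| / N < 2 :=
    (tendsto_const_div_atTop_nhds_zero_nat |a - b|).eventually_lt_const two_pos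
  filter_upwards [hsmall, eventually_gt_atTop 0] with N hN hN0
  have hN0' : (0 : ℝ) < N := by exact_mod_cast hN0
  have hstep (k : ℕ) : angle (T (a + k * ((b - a) / N))) (T (a + (k + 1 : ℕ) * ((b - a) / N)))
      ≤ 2 * Real.arcsin (|a - b| / N / 2) := by
    refine angle_le_two_mul_arcsin (hunit _) (hunit _) ?_ hN.le
    have h := hT.dist_le_mul (a + k * ((b - a) / N)) (a + (k + 1 : ℕ) * ((b - a) / N))
    rw [dist_eq_norm, Real.dist_eq, NNReal.coe_one, one_mul] at h
    refine h.trans_eq ?_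
    rw [← abs_of_pos hN0', ← abs_div, abs_of_pos hN0']
    congr 1
    push_cast
    ring
  have hsum (k : ℕ) : angle (T a) (T (a + k * ((b - a) / N)))
      ≤ k * (2 * Real.arcsin (|a - b| / N / 2)) := by
    induction k with
    | zero =>
      have : T a ≠ 0 := norm_ne_zero_iff.1 (by simp [hunit])
      simp [angle_self this]
    | succ k ih =>
      refine (angle_le_angle_add_angle _ (T (a + k * ((b - a) / N))) _).trans ?_
      have := hstep k
      push_cast at this ⊢
      linarith
  have h := hsum N
  rwa [mul_div_cancel₀ _ hN0'.ne', add_sub_cancel] at h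

/-- The chord bound of Schur's theorem for ordered parameters. -/
theorem two_mul_sin_half_le_norm_sub {E : Type*} [NormedAddCommGroup E] [InnerProductSpace ℝ E]
    {γ γ' : ℝ → E} (hderiv : ∀ s, HasDerivAt γ (γ' s) s) (hunit : ∀ s, ‖γ' s‖ = 1)
    (hlip : LipschitzWith 1 γ') {s t : ℝ} (hst : s ≤ t) (hπ : t - s ≤ 2 * Real.pi) :
    2 * Real.sin ((t - s) / 2) ≤ ‖γ t - γ s‖ := by
  set m := (s + t) / 2 with hm
  have hd (r : ℝ) : HasDerivAt (fun r => inner ℝ (γ' m) (γ r) - Real.sin (r - m))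
      (inner ℝ (γ' m) (γ' r) - Real.cos (r - m)) r := by
    have h1 : HasDerivAt (fun r => inner ℝ (γ' m) (γ r)) (inner ℝ (γ' m) (γ' r)) r := by
      simpa using (hasDerivAt_const r (γ' m)).inner ℝ (hderiv r)
    have h2 : HasDerivAt (fun r => Real.sin (r - m)) (Real.cos (r - m)) r := by
      simpa using ((hasDerivAt_id r).sub_const m).sin
    exact h1.sub h2
  have hmono : MonotoneOn (fun r => inner ℝ (γ' m) (γ r) - Real.sin (r - m)) (Set.Icc s t) := by
    refine monotoneOn_of_deriv_nonneg (convex_Icc s t)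
      (fun r _ => (hd r).continuousAt.continuousWithinAt)
      (fun r _ => (hd r).differentiableAt.differentiableWithinAt) fun r hr => ?_
    rw [interior_Icc] at hr
    rw [(hd r).deriv, sub_nonneg, ← InnerProductGeometry.cos_angle_mul_norm_mul_norm,
      hunit, hunit, mul_one, mul_one, ← Real.cos_abs, abs_sub_comm]
    refine Real.cos_le_cos_of_nonneg_of_le_pi (InnerProductGeometry.angle_nonneg _ _) ?_
      (hlip.angle_le_dist hunit m r)
    rw [abs_le]
    constructor <;> linarith [hr.1, hr.2]
  have h := hmono (Set.left_mem_Icc.2 hst) (Set.right_mem_Icc.2 hst) hst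
  have hs : s - m = -((t - s) / 2) := by rw [hm]; ring
  have ht : t - m = (t - s) / 2 := by rw [hm]; ring
  simp only [hs, ht, Real.sin_neg] at h
  have hcs := real_inner_le_norm (γ' m) (γ t - γ s)
  rw [hunit, one_mul, inner_sub_right] at hcs
  linarith

/-- Schur's lemma, special case: If `γ : ℝ → ℝⁿ` is a unit-speed curve
whose derivative is 1-Lipschitz (curvature at most 1), then for `|s - t| ≤ 2π` the
chord length satisfies `‖γ s - γ t‖ ≥ 2·sin(|s - t|/2)`. -/
theorem chord_ge_of_curvature_le_one (n : ℕ) (hn : 1 ≤ n)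
    (γ γ' : ℝ → EuclideanSpace ℝ (Fin n))
    (hderiv : ∀ s : ℝ, HasDerivAt γ (γ' s) s)
    (hunit : ∀ s : ℝ, ‖γ' s‖ = 1)
    (hlip : LipschitzWith 1 γ') :
    ∀ s t : ℝ, |s - t| ≤ 2 * Real.pi →
      2 * Real.sin (|s - t| / 2) ≤ ‖γ s - γ t‖ := by
  intro s t hst
  rcases le_total s t with h | h
  · rw [abs_sub_comm, abs_of_nonneg (sub_nonneg.2 h)] at hst ⊢
    rw [norm_sub_rev]
    exact two_mul_sin_half_le_norm_sub hderiv hunit hlip h hst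
  · rw [abs_of_nonneg (sub_nonneg.2 h)] at hst ⊢
    exact two_mul_sin_half_le_norm_sub hderiv hunit hlip h hst
end
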